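/- Assume log c is m-integrable, and assume there exist measurable functions x, x' : E → ℝ such that x[n](e) → x(e) and x'[n](e) → x'(e) pointwise as n → ∞. Then log x and log x' are m-integrable and ∫ log x dm = ∫ log x' dm. -/

import Mathlib

open MeasureTheory Filter

/-- Sum over subsets with non-adjacent omissions of the first `n` values of `c` along the orbit. -/
noncomputable def contR {E : Type*} (S : E → E) (c : E → ℝ) : ℕ → E → ℝ
  | 0, _ => 1
  | 1, e => 1 + c e
  | (n + 2), e => c e * contR S c (n + 1) (S e) + c (S e) * contR S c n (S (S e))

theorem contR_pos {E : Type*} (S : E → E) (c : E → ℝ) (hc : ∀ e, 0 < c e) :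
    ∀ n e, 0 < contR S c n e
  | 0, _ => by simp [contR]
  | 1, e => by have := hc e; simp only [contR]; linarith
  | (n + 2), e => by
    have h1 := contR_pos S c hc (n + 1) (S e)
    have h2 := contR_pos S c hc n (S (S e))
    have := hc e
    have := hc (S e)
    simp only [contR]
    positivity

theorem contR_right {E : Type*} (S : E → E) (c : E → ℝ) :
    ∀ n e, contR S c (n + 2) e
      = c (S^[n + 1] e) * contR S c (n + 1) e + c (S^[n] e) * contR S c n e
  | 0, e => by simp [contR]; ring
  | 1, e => by simp [contR]; ring
  | (n + 2), e => by
    have h1 := contR_right S c (n + 1) (S e)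
    have h2 := contR_right S c n (S (S e))
    have e1 : contR S c (n + 2 + 2) e = c e * contR S c (n + 3) (S e)
      + c (S e) * contR S c (n + 2) (S (S e)) := rfl
    have e2 : contR S c (n + 2 + 1) e = c e * contR S c (n + 2) (S e)
      + c (S e) * contR S c (n + 1) (S (S e)) := rfl
    have e3 : contR S c (n + 2) e = c e * contR S c (n + 1) (S e)
      + c (S e) * contR S c n (S (S e)) := rfl
    rw [e1, e2, e3, h1, h2]
    simp only [Function.iterate_succ_apply]
    ring

theorem left_id {E : Type*} (S : E → E) (c : E → ℝ) (hc : ∀ e, 0 < c e) (x' : ℕ → E → ℝ)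
    (hx'0 : ∀ e, x' 0 e = c e)
    (hx's : ∀ n e, x' (n + 1) e = c e * (1 + 1 / x' n (S e))) (n : ℕ) :
    ∀ e, x' (n + 1) e * (c (S e) * contR S c n (S (S e))) = c e * contR S c (n + 1) (S e) := by
  induction n with
  | zero =>
    intro e
    have := hc (S e)
    rw [hx's, hx'0]
    simp only [contR]
    field_simp
    ring
  | succ n ih =>
    intro e
    have h := ih (S e)
    have p1 := hc (S e)
    have p2 := hc (S (S e))
    have p3 := contR_pos S c hc n (S (S (S e)))
    have p4 := contR_pos S c hc (n + 1) (S (S e))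
    have h' : x' (n + 1) (S e) = c (S e) * contR S c (n + 1) (S (S e)) /
      (c (S (S e)) * contR S c n (S (S (S e)))) := by
      rw [eq_div_iff (by positivity)]; exact h
    rw [hx's, h']
    simp only [contR]
    field_simp

theorem right_id {E : Type*} (S : E ≃ E) (c : E → ℝ) (hc : ∀ e, 0 < c e) (x : ℕ → E → ℝ)
    (hx0 : ∀ e, x 0 e = c e)
    (hxs : ∀ n e, x (n + 1) e = c e * (1 + 1 / x n (S.symm e))) (n : ℕ) (e : E) :
    x (n + 1) (S^[n + 1] e) * (c (S^[n] e) * contR S c n e)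
      = c (S^[n + 1] e) * contR S c (n + 1) e := by
  induction n with
  | zero =>
    have := hc e
    rw [hxs, hx0]
    simp [contR]
    field_simp
    ring
  | succ n ih =>
    have p1 := hc (S^[n] e)
    have p2 := hc (S^[n + 1] e)
    have p3 := contR_pos S c hc n e
    have p4 := contR_pos S c hc (n + 1) e
    have h' : x (n + 1) (S^[n + 1] e) = c (S^[n + 1] e) * contR S c (n + 1) e /
      (c (S^[n] e) * contR S c n e) := by
      rw [eq_div_iff (by positivity)]; exact ih
    have hs : S.symm (S^[n + 1 + 1] e) = S^[n + 1] e := by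
      rw [Function.iterate_succ_apply', Equiv.symm_apply_apply]
    rw [hxs, hs, h', contR_right]
    field_simp

theorem sandwich_pt (a b u : ℝ) (ha : 0 < a) (hb : 0 < b) (h1 : a ≤ u) (h2 : u ≤ a * (1 + 1 / b)) :
    |Real.log u| ≤ |Real.log a| + (Real.log 2 + |Real.log b|) := by
  have hu : 0 < u := by linarith
  have l1 := Real.log_le_log ha h1
  have l2 := Real.log_le_log hu h2
  rw [Real.log_mul (by positivity) (by positivity)] at l2
  have l3 : Real.log (1 + 1 / b) ≤ Real.log 2 + |Real.log b| := by
    have h20 : (0 : ℝ) ≤ Real.log 2 := Real.log_nonneg (by norm_num)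
    rcases le_total b 1 with hb1 | hb1
    · have : 1 + 1 / b ≤ 2 * b⁻¹ := by
        have : 1 ≤ b⁻¹ := (one_le_inv₀ hb).2 hb1
        rw [one_div]; linarith
      have := Real.log_le_log (by positivity) this
      rw [Real.log_mul (by norm_num) (by positivity), Real.log_inv] at this
      have := neg_abs_le (Real.log b)
      linarith
    · have : 1 + 1 / b ≤ 2 := by
        have : 1 / b ≤ 1 := by rw [div_le_one hb]; exact hb1
        linarith
      have := Real.log_le_log (by positivity) this
      have := abs_nonneg (Real.log b)
      linarith
  have h20 : (0 : ℝ) ≤ Real.log 2 := Real.log_nonneg (by norm_num)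
  have := abs_nonneg (Real.log b)
  have := neg_abs_le (Real.log a)
  have := le_abs_self (Real.log a)
  rw [abs_le]
  constructor <;> linarith

theorem half {E : Type*} [MeasurableSpace E] (m : Measure E)
    [IsProbabilityMeasure m] (T : E → E) (hT : MeasurePreserving T m m)
    (c : E → ℝ) (hcm : Measurable c) (hc : ∀ e, 0 < c e)
    (x : ℕ → E → ℝ)
    (hx0 : ∀ e, x 0 e = c e)
    (hxs : ∀ n e, x (n + 1) e = c e * (1 + 1 / x n (T e)))
    (hlogc : Integrable (fun e => Real.log (c e)) m)
    (X : E → ℝ) (hXm : Measurable X)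
    (hX : ∀ e, Tendsto (fun n => x n e) atTop (nhds (X e))) :
    (∀ n e, 0 < x n e) ∧ (∀ n, Integrable (fun e => Real.log (x n e)) m) ∧
    Integrable (fun e => Real.log (X e)) m ∧
    Tendsto (fun n => ∫ e, Real.log (x n e) ∂m) atTop (nhds (∫ e, Real.log (X e) ∂m)) := by
  have hlow : ∀ n e, c e ≤ x n e := by
    intro n
    induction n with
    | zero => intro e; rw [hx0]
    | succ n ih =>
      intro e
      rw [hxs]
      have h1 := hc e
      have h2 : 0 < x n (T e) := lt_of_lt_of_le (hc _) (ih _)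
      have : 0 ≤ 1 / x n (T e) := by positivity
      nlinarith
  have hup : ∀ n e, x n e ≤ c e * (1 + 1 / c (T e)) := by
    intro n e
    have h1 := hc e
    have h2 := hc (T e)
    cases n with
    | zero =>
      rw [hx0]
      have : 0 ≤ 1 / c (T e) := by positivity
      nlinarith
    | succ n =>
      rw [hxs]
      have := one_div_le_one_div_of_le h2 (hlow n (T e))
      gcongr
  have hmeas : ∀ n, Measurable (x n) := by
    intro n
    induction n with
    | zero => rw [show x 0 = c from funext hx0]; exact hcm
    | succ n ih =>
      rw [show x (n + 1) = fun e => c e * (1 + 1 / x n (T e)) from funext (hxs n)]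
      exact hcm.mul (measurable_const.add (measurable_const.div (ih.comp hT.measurable)))
  have hXl : ∀ e, c e ≤ X e := fun e => ge_of_tendsto' (hX e) (fun n => hlow n e)
  have hXu : ∀ e, X e ≤ c e * (1 + 1 / c (T e)) := fun e =>
    le_of_tendsto' (hX e) (fun n => hup n e)
  have hbd : Integrable (fun e => |Real.log (c e)| + (Real.log 2 + |Real.log (c (T e))|)) m := by
    refine hlogc.abs.add ((integrable_const _).add ?_)
    exact (hT.integrable_comp_of_integrable hlogc).abs
  have hb : ∀ u : E → ℝ, (∀ e, c e ≤ u e) → (∀ e, u e ≤ c e * (1 + 1 / c (T e))) →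
      ∀ e, ‖Real.log (u e)‖ ≤ |Real.log (c e)| + (Real.log 2 + |Real.log (c (T e))|) :=
    fun u h1 h2 e => sandwich_pt _ _ _ (hc e) (hc _) (h1 e) (h2 e)
  refine ⟨fun n e => lt_of_lt_of_le (hc e) (hlow n e), fun n => ?_, ?_, ?_⟩
  · exact hbd.mono' (Real.measurable_log.comp (hmeas n)).aestronglyMeasurable
      (ae_of_all _ (hb _ (hlow n) (hup n)))
  · exact hbd.mono' (Real.measurable_log.comp hXm).aestronglyMeasurable
      (ae_of_all _ (hb _ hXl hXu))
  · refine tendsto_integral_of_dominated_convergence _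
      (fun n => (Real.measurable_log.comp (hmeas n)).aestronglyMeasurable) hbd
      (fun n => ae_of_all _ (hb _ (hlow n) (hup n))) (ae_of_all _ fun e => ?_)
    exact (hX e).log (lt_of_lt_of_le (hc e) (hXl e)).ne'

theorem int_comp {E : Type*} [MeasurableSpace E] {m : Measure E} {T : E → E}
    (hT : MeasurePreserving T m m) {f : E → ℝ} (hf : Integrable f m) :
    ∫ e, f (T e) ∂m = ∫ e, f e ∂m := by
  have h := integral_map (μ := m) hT.measurable.aemeasurable (f := f)
    (by rw [hT.map_eq]; exact hf.aestronglyMeasurable)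
  rw [hT.map_eq] at h
  exact h.symm

theorem int_four {E : Type*} [MeasurableSpace E] {m : Measure E} {f g h k : E → ℝ}
    (hf : Integrable f m) (hg : Integrable g m) (hh : Integrable h m) (hk : Integrable k m) :
    ∫ e, ((f e - g e) + (h e - k e)) ∂m
      = (∫ e, f e ∂m - ∫ e, g e ∂m) + (∫ e, h e ∂m - ∫ e, k e ∂m) := by
  rw [← integral_sub hf hg, ← integral_sub hh hk]
  exact integral_add (hf.sub hg) (hh.sub hk)

theorem log_four {a b c d : ℝ} {r : ℝ} (ha : 0 < a) (hb : 0 < b) (hc : 0 < c) (hd : 0 < d)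
    (hr : 0 < r) (h : a * (b * c) = d * r) :
    Real.log a = (Real.log d - Real.log b) + (Real.log r - Real.log c) := by
  have := congrArg Real.log h
  rw [Real.log_mul ha.ne' (by positivity), Real.log_mul hb.ne' hc.ne',
    Real.log_mul hd.ne' hr.ne'] at this
  linarith

theorem stmt_12 {E : Type*} [MeasurableSpace E] (m : Measure E)
    [IsProbabilityMeasure m]
    (S : E ≃ E) (hS : MeasurePreserving S m m) (hSsymm : Measurable ⇑S.symm)
    (c : E → ℝ) (hcm : Measurable c) (hc : ∀ e, 0 < c e)
    (x x' : ℕ → E → ℝ)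
    (hx0 : ∀ e, x 0 e = c e)
    (hxs : ∀ n e, x (n + 1) e = c e * (1 + 1 / x n (S.symm e)))
    (hx'0 : ∀ e, x' 0 e = c e)
    (hx's : ∀ n e, x' (n + 1) e = c e * (1 + 1 / x' n (S e)))
    (hlogc : Integrable (fun e => Real.log (c e)) m)
    (X X' : E → ℝ) (hXm : Measurable X) (hX'm : Measurable X')
    (hX : ∀ e, Tendsto (fun n => x n e) atTop (nhds (X e)))
    (hX' : ∀ e, Tendsto (fun n => x' n e) atTop (nhds (X' e))) :
    Integrable (fun e => Real.log (X e)) m ∧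
      Integrable (fun e => Real.log (X' e)) m ∧
      ∫ e, Real.log (X e) ∂m = ∫ e, Real.log (X' e) ∂m := by
  have hS' : MeasurePreserving S.symm m m :=
    hS.symm ⟨S, hS.measurable, hSsymm⟩
  obtain ⟨xp, xi, Xi, xt⟩ := half m S.symm hS' c hcm hc x hx0 hxs hlogc X hXm hX
  obtain ⟨x'p, x'i, X'i, x't⟩ := half m S hS c hcm hc x' hx'0 hx's hlogc X' hX'm hX'
  have Rp := contR_pos S c hc
  have kr : ∀ n e, Real.log (x (n + 1) (S^[n + 1] e)) =
      (Real.log (c (S^[n + 1] e)) - Real.log (c (S^[n] e)))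
        + (Real.log (contR S c (n + 1) e) - Real.log (contR S c n e)) := fun n e =>
    log_four (xp _ _) (hc _) (Rp _ _) (hc _) (Rp _ _) (right_id S c hc x hx0 hxs n e)
  have kl : ∀ n e, Real.log (x' (n + 1) e) =
      (Real.log (c e) - Real.log (c (S e)))
        + (Real.log (contR S c (n + 1) (S e)) - Real.log (contR S c n (S (S e)))) := fun n e =>
    log_four (x'p _ _) (hc _) (Rp _ _) (hc _) (Rp _ _) (left_id S c hc x' hx'0 hx's n e)
  have ci : ∀ n, Integrable (fun e => Real.log (c (S^[n] e))) m := fun n =>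
    (hS.iterate n).integrable_comp_of_integrable hlogc
  have cI : ∀ n, ∫ e, Real.log (c (S^[n] e)) ∂m = ∫ e, Real.log (c e) ∂m := fun n =>
    int_comp (hS.iterate n) hlogc
  have xi2 : ∀ n, Integrable (fun e => Real.log (x n (S^[n] e))) m := fun n =>
    (hS.iterate n).integrable_comp_of_integrable (xi n)
  have Ri : ∀ n, Integrable (fun e => Real.log (contR S c n e)) m := by
    intro n
    induction n with
    | zero => simp [contR]
    | succ n ih =>
      refine (((xi2 (n + 1)).sub ((ci (n + 1)).sub (ci n))).add ih).congr (ae_of_all _ fun e => ?_)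
      have := kr n e
      simp only [Pi.add_apply, Pi.sub_apply]
      linarith
  have key : ∀ n, ∫ e, Real.log (x (n + 1) e) ∂m = ∫ e, Real.log (x' (n + 1) e) ∂m := by
    intro n
    have RS := hS.integrable_comp_of_integrable (Ri (n + 1))
    have RSS := (hS.comp hS).integrable_comp_of_integrable (Ri n)
    have cS := hS.integrable_comp_of_integrable hlogc
    have A : ∫ e, Real.log (x (n + 1) e) ∂m =
        ∫ e, Real.log (contR S c (n + 1) e) ∂m - ∫ e, Real.log (contR S c n e) ∂m := by
      rw [← int_comp (hS.iterate (n + 1)) (xi (n + 1))]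
      simp only [kr]
      rw [int_four (ci _) (ci _) (Ri _) (Ri _), cI, cI]
      ring
    have B : ∫ e, Real.log (x' (n + 1) e) ∂m =
        ∫ e, Real.log (contR S c (n + 1) e) ∂m - ∫ e, Real.log (contR S c n e) ∂m := by
      simp only [kl]
      have i1 := int_comp hS hlogc
      have i2 := int_comp hS (Ri (n + 1))
      have i3 := int_comp (hS.comp hS) (Ri n)
      simp only [Function.comp_apply] at i3
      have q := int_four hlogc cS RS RSS
      simp only [Function.comp_apply] at q
      rw [q, i1, i2, i3]
      ring
    rw [A, B]
  refine ⟨Xi, X'i, ?_⟩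
  have t1 := (tendsto_add_atTop_iff_nat 1).2 xt
  have t2 := (tendsto_add_atTop_iff_nat 1).2 x't
  simp only [key] at t1
  exact tendsto_nhds_unique t1 t2
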